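/- Proposition (construction for ICL sequences): Consider the 1-layer 2-head attention-only model with subject-head weights W_KQ^subj = β(Σ_{j=1}^M E(s_j) + E(p_{-1}))E([sep])^T, W_OV^subj = -Σ_j (Σ_{u∈U, u∉A_j} E(u)) E(s_j)^T, and relation-head weights W_KQ^rel = β Σ_{l=1}^L (Σ_{u∈U_l} E(u)) E([sep])^T, W_OV^rel = Σ_{l=1}^L (Σ_{u∈U_l} E(u))(Σ_{u∈U_l} E(u) + E(r_l))^T. Then for every ICL sequence X with shared attribute type l* and query subject s_{j_m}, in the limit β→∞ the unique maximizer of v ↦ E(v)^T f(X) over the vocabulary is a_{j_m}^{l*}, i.e., the model correctly predicts the query subject's attribute of the shared type. -/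

import Mathlib

open Filter Topology Finset Matrix

namespace CR

/-- Vocabulary tokens: `M` subjects, `L` attribute types each with `U` values,
`G` grammar tokens, `L` relation tokens, and a separator. -/
inductive Tok (M L U G : ℕ) : Type where
  | subj : Fin M → Tok M L U G
  | attr : Fin L → Fin U → Tok M L U G
  | gram : Fin G → Tok M L U G
  | rel  : Fin L → Tok M L U G
  | sep  : Tok M L U G
deriving DecidableEq, Fintype

/-- Embedding dimension: one coordinate per vocabulary token plus `P` positional coordinates. -/
abbrev Dim (M L U G P : ℕ) := Tok M L U G ⊕ Fin P

abbrev Vec (M L U G P : ℕ) := Dim M L U G P → ℝ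

variable {M L U G P : ℕ}

/-- One-hot token embedding `E(v)`. -/
def E (v : Tok M L U G) : Vec M L U G P :=
  fun i => if i = Sum.inl v then 1 else 0

/-- One-hot positional encoding for relative position `-k`
(`pos 0 = E(p₀)`, `pos 1 = E(p₋₁)`, ...); zero if `k ≥ P`. -/
def pos (k : ℕ) : Vec M L U G P :=
  fun i => match i with
  | Sum.inl _ => 0
  | Sum.inr j => if (j : ℕ) = k then 1 else 0

/-- Softmax attention weight of (0-indexed) row `j` among rows `0,…,t-1`, with query row `t-1`;
row `i` carries the relative positional encoding `p_{-(t-1-i)}`. -/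
noncomputable def attn (W : Matrix (Dim M L U G P) (Dim M L U G P) ℝ)
    (X : ℕ → Vec M L U G P) (t j : ℕ) : ℝ :=
  Real.exp ((X j + pos (t - 1 - j)) ⬝ᵥ W.mulVec (X (t - 1))) /
    ∑ i ∈ Finset.range t, Real.exp ((X i + pos (t - 1 - i)) ⬝ᵥ W.mulVec (X (t - 1)))

/-- Attention-head output `g_h^t(X)` (attention over the first `t` rows, query at row `t-1`). -/
noncomputable def gHead (W : Matrix (Dim M L U G P) (Dim M L U G P) ℝ)
    (X : ℕ → Vec M L U G P) (t : ℕ) : Vec M L U G P :=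
  ∑ j ∈ Finset.range t, attn W X t j • X j

/-- Token at (0-indexed) position `t` of a PT sequence with subject `jstar`:
block `k` occupies positions `k(S+3),…,k(S+3)+S+1` (subject, `S` middle tokens, separator),
followed (except after the last block) by the attribute `a_{jstar}^{ltype k}`. -/
def ptTok (S : ℕ) (jstar : Fin M) (ltype : ℕ → Fin L)
    (mid : ℕ → ℕ → Tok M L U G) (a : Fin M → Fin L → Fin U) (t : ℕ) : Tok M L U G :=
  let k := t / (S + 3)
  let r := t % (S + 3)
  if r = 0 then Tok.subj jstar
  else if r ≤ S then mid k (r - 1)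
  else if r = S + 1 then Tok.sep
  else Tok.attr (ltype k) (a jstar (ltype k))

/-- Token at (0-indexed) position `t` of an ICL sequence with shared attribute type `lstar`
and subjects `js 0, js 1, …`: the pattern is subject, separator, attribute, subject, … -/
def iclTok (a : Fin M → Fin L → Fin U) (js : ℕ → Fin M) (lstar : Fin L) (t : ℕ) :
    Tok M L U G :=
  if t % 3 = 0 then Tok.subj (js (t / 3))
  else if t % 3 = 1 then Tok.sep
  else Tok.attr lstar (a (js (t / 3)) lstar)


lemma E_dot (v : Tok M L U G) (x : Vec M L U G P) : E v ⬝ᵥ x = x (Sum.inl v) := by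
  simp [dotProduct, E]

lemma dot_E (v : Tok M L U G) (x : Vec M L U G P) : x ⬝ᵥ E v = x (Sum.inl v) := by
  simp [dotProduct, E]

lemma vmv (x y z : Vec M L U G P) : (Matrix.vecMulVec x y).mulVec z = (y ⬝ᵥ z) • x := by
  ext i
  rw [Matrix.vecMulVec_mulVec]
  simp [mul_comm]

/-- Softmax at inverse temperature going to infinity. -/
lemma softmax_lim (s : ℕ → ℝ) (T : ℕ) (m : ℝ) (hle : ∀ i < T, s i ≤ m)
    (i0 : ℕ) (hi0 : i0 < T) (h0 : s i0 = m) (j : ℕ) (hj : j < T) :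
    Tendsto (fun β : ℝ => Real.exp (β * s j) / ∑ i ∈ Finset.range T, Real.exp (β * s i))
      atTop (𝓝 ((if s j = m then (1 : ℝ) else 0) /
        ∑ i ∈ Finset.range T, (if s i = m then (1 : ℝ) else 0))) := by
  have key : ∀ i < T, Tendsto (fun β : ℝ => Real.exp (β * (s i - m))) atTop
      (𝓝 (if s i = m then (1 : ℝ) else 0)) := by
    intro i hi
    split_ifs with h
    · simp [h]
    · have : s i - m < 0 := sub_neg.mpr (lt_of_le_of_ne (hle i hi) h)
      exact Real.tendsto_exp_atBot.comp (tendsto_id.atTop_mul_const_of_neg this)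
  have hpos : (0 : ℝ) < ∑ i ∈ Finset.range T, (if s i = m then (1 : ℝ) else 0) := by
    refine Finset.sum_pos' (fun i _ => by split_ifs <;> norm_num)
      ⟨i0, Finset.mem_range.mpr hi0, by simp [h0]⟩
  have h1 := (key j hj).div
    (tendsto_finsetSum (Finset.range T) fun i hi => key i (Finset.mem_range.mp hi)) hpos.ne'
  refine h1.congr fun β => ?_
  have e : ∀ i, Real.exp (β * (s i - m)) = Real.exp (β * s i) * Real.exp (-(β * m)) := by
    intro i; rw [← Real.exp_add]; ring_nf
  simp only [Pi.div_apply, e, ← Finset.sum_mul]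
  exact mul_div_mul_right _ _ (Real.exp_pos _).ne'

/-- The limit of one head, tested against a token. -/
lemma head_lim (k : Vec M L U G P) (W : Matrix (Dim M L U G P) (Dim M L U G P) ℝ)
    (X : ℕ → Vec M L U G P) (T : ℕ) (hq : X (T - 1) = E Tok.sep) (s : ℕ → ℝ)
    (hs : ∀ i < T, (X i + pos (T - 1 - i)) ⬝ᵥ k = s i) (m : ℝ)
    (hle : ∀ i < T, s i ≤ m) (i0 : ℕ) (hi0 : i0 < T) (h0 : s i0 = m) (v : Tok M L U G)
    (c : ℝ) (hc : ∀ i < T, s i = m → W.mulVec (X i) (Sum.inl v) = c) :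
    Tendsto (fun β : ℝ => W.mulVec (gHead (β • Matrix.vecMulVec k (E Tok.sep)) X T) (Sum.inl v))
      atTop (𝓝 c) := by
  have hscore : ∀ β : ℝ, ∀ i < T, (X i + pos (T - 1 - i)) ⬝ᵥ
      (β • Matrix.vecMulVec k (E Tok.sep)).mulVec (X (T - 1)) = β * s i := by
    intro β i hi
    rw [Matrix.smul_mulVec, vmv, hq, E_dot, dotProduct_smul, dotProduct_smul, hs i hi]
    simp [E]
  have hpos : (0 : ℝ) < ∑ i ∈ Finset.range T, (if s i = m then (1 : ℝ) else 0) := by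
    refine Finset.sum_pos' (fun i _ => by split_ifs <;> norm_num)
      ⟨i0, Finset.mem_range.mpr hi0, by simp [h0]⟩
  have h1 := tendsto_finsetSum (Finset.range T) fun j hj =>
    (softmax_lim s T m hle i0 hi0 h0 j (Finset.mem_range.mp hj)).mul_const
      (W.mulVec (X j) (Sum.inl v))
  have e1 : ∑ j ∈ Finset.range T, ((if s j = m then (1 : ℝ) else 0) /
        ∑ i ∈ Finset.range T, (if s i = m then (1 : ℝ) else 0)) * W.mulVec (X j) (Sum.inl v)
      = c := by
    have : ∀ j ∈ Finset.range T, ((if s j = m then (1 : ℝ) else 0) /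
        ∑ i ∈ Finset.range T, (if s i = m then (1 : ℝ) else 0)) * W.mulVec (X j) (Sum.inl v)
        = (if s j = m then (1 : ℝ) else 0) *
          (c / ∑ i ∈ Finset.range T, (if s i = m then (1 : ℝ) else 0)) := by
      intro j hj
      by_cases h : s j = m
      · rw [hc j (Finset.mem_range.mp hj) h]; ring
      · simp [h]
    rw [Finset.sum_congr rfl this, ← Finset.sum_mul]
    field_simp
  rw [e1] at h1
  refine h1.congr fun β => ?_
  unfold gHead
  rw [Matrix.mulVec_sum, Finset.sum_apply]
  refine Finset.sum_congr rfl fun j hj => ?_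
  rw [Matrix.mulVec_smul, Pi.smul_apply, smul_eq_mul]
  congr 1
  unfold attn
  rw [hscore β j (Finset.mem_range.mp hj)]
  congr 1
  exact Finset.sum_congr rfl fun i hi => by rw [hscore β i (Finset.mem_range.mp hi)]

/-- Proposition (construction for ICL sequences). -/
theorem icl_construction
    (M L U G P N : ℕ) (hN : 0 < N) (T : ℕ) (hT : T = 3 * (N + 1) - 1) (hP : T ≤ P)
    (a : Fin M → Fin L → Fin U) (lstar : Fin L) (js : ℕ → Fin M)
    (X : ℕ → Vec M L U G P) (hX : ∀ t, X t = E (iclTok a js lstar t))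
    (WKQsubj WOVsubj WKQrel WOVrel : Matrix (Dim M L U G P) (Dim M L U G P) ℝ)
    (hKQsubj : WKQsubj = Matrix.vecMulVec
      ((∑ j : Fin M, E (Tok.subj j)) + pos 1) (E Tok.sep))
    (hOVsubj : WOVsubj = -(∑ j : Fin M, Matrix.vecMulVec
      (∑ l : Fin L, ∑ u ∈ Finset.univ.erase (a j l), E (Tok.attr l u))
      (E (Tok.subj j))))
    (hKQrel : WKQrel = Matrix.vecMulVec
      (∑ l : Fin L, ∑ u : Fin U, E (Tok.attr l u)) (E Tok.sep))
    (hOVrel : WOVrel = ∑ l : Fin L, Matrix.vecMulVec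
      (∑ u : Fin U, E (Tok.attr l u))
      ((∑ u : Fin U, E (Tok.attr l u)) + E (Tok.rel l))) :
    ∃ F : Tok M L U G → ℝ,
      (∀ v, Filter.Tendsto (fun β : ℝ =>
          E v ⬝ᵥ (WOVsubj.mulVec (gHead (β • WKQsubj) X T)
            + WOVrel.mulVec (gHead (β • WKQrel) X T)))
        Filter.atTop (𝓝 (F v))) ∧
      ∀ w, w ≠ Tok.attr lstar (a (js N) lstar) →
        F w < F (Tok.attr lstar (a (js N) lstar)) := by
  have hq : X (T - 1) = E Tok.sep := by
    rw [hX]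
    have h1 : (T - 1) % 3 = 1 := by omega
    simp [iclTok, h1]
  refine ⟨fun v => -(∑ l : Fin L, ∑ u ∈ Finset.univ.erase (a (js N) l),
      (if v = Tok.attr l u then (1 : ℝ) else 0))
      + ∑ u : Fin U, (if v = Tok.attr lstar u then (1 : ℝ) else 0), ?_, ?_⟩
  · intro v
    simp only [E_dot, Pi.add_apply]
    refine Tendsto.add ?_ ?_
    · subst hKQsubj
      refine head_lim _ _ X T hq
        (fun i => (if i % 3 = 0 then 1 else 0) + (if i = T - 2 then 1 else 0)) ?_ 2 ?_
        (3 * N) (by omega) ?_ v _ ?_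
      · intro i hi
        have hp : (pos (T - 1 - i) : Vec M L U G P) ⬝ᵥ pos 1 = if i = T - 2 then 1 else 0 := by
          have h1P : 1 < P := by omega
          simp only [dotProduct, Fintype.sum_sum_type, pos]
          rw [Finset.sum_eq_single (⟨1, h1P⟩ : Fin P)]
          · simp
            split_ifs <;> first | rfl | omega
          · intro b _ hb
            have : (b : ℕ) ≠ 1 := fun h => hb (Fin.ext h)
            simp [this]
          · simp
        have hz : (pos (T - 1 - i) : Vec M L U G P) ⬝ᵥ ∑ j : Fin M, E (Tok.subj j) = 0 := by
          simp [dotProduct_sum, dot_E, pos]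
        rw [dotProduct_add, add_dotProduct, add_dotProduct, hp, hz, hX, E_dot, E_dot]
        have h3 : i % 3 = 0 ∨ i % 3 = 1 ∨ i % 3 = 2 := by omega
        rcases h3 with h | h | h <;> simp [iclTok, h, E, pos]
      · intro i hi
        split_ifs <;> norm_num
      · have : 3 * N = T - 2 := by omega
        simp [← this]
        norm_num
      · intro i hi h
        have hi' : i = 3 * N := by
          by_contra hne
          have : ¬ i = T - 2 := by omega
          simp only [this, if_false] at h
          split_ifs at h <;> norm_num at h
        subst hi'
        rw [hX, hOVsubj]
        have ht : (iclTok a js lstar (3 * N) : Tok M L U G) = Tok.subj (js N) := by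
          simp [iclTok]
        have hE : ∀ j : Fin M, (E (Tok.subj j) : Vec M L U G P) (Sum.inl (Tok.subj (js N)))
            = if js N = j then 1 else 0 := by
          intro j; simp [E]
        rw [ht, Matrix.neg_mulVec, Matrix.sum_mulVec]
        simp only [vmv, dot_E, hE, ite_smul, one_smul, zero_smul, Finset.sum_ite_eq,
          Finset.mem_univ, if_true, Pi.neg_apply, Finset.sum_apply]
        simp only [E, Sum.inl.injEq]
    · subst hKQrel
      refine head_lim _ _ X T hq
        (fun i => (if i % 3 = 2 then 1 else 0)) ?_ 1 ?_
        2 (by omega) (by simp) v _ ?_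
      · intro i hi
        have hz : (pos (T - 1 - i) : Vec M L U G P) ⬝ᵥ
            ∑ l : Fin L, ∑ u : Fin U, E (Tok.attr l u) = 0 := by
          simp [dotProduct_sum, dot_E, pos]
        rw [add_dotProduct, hz, hX, E_dot]
        have h3 : i % 3 = 0 ∨ i % 3 = 1 ∨ i % 3 = 2 := by omega
        rcases h3 with h | h | h <;> simp [iclTok, h, E, ite_and]
      · intro i hi
        split_ifs <;> norm_num
      · intro i hi h
        have h2 : i % 3 = 2 := by
          by_contra hne
          simp [hne] at h
        rw [hX, hOVrel]
        have ht : (iclTok a js lstar i : Tok M L U G)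
            = Tok.attr lstar (a (js (i / 3)) lstar) := by
          simp [iclTok, h2]
        have hE : ∀ l : Fin L, ((∑ u : Fin U, E (Tok.attr l u)) + E (Tok.rel l) : Vec M L U G P)
            (Sum.inl (Tok.attr lstar (a (js (i / 3)) lstar)))
            = if lstar = l then 1 else 0 := by
          intro l; simp [E, Finset.sum_apply, ite_and]
        rw [ht, Matrix.sum_mulVec]
        simp only [vmv, dot_E, hE, ite_smul, one_smul, zero_smul, Finset.sum_ite_eq,
          Finset.mem_univ, if_true]
        simp only [Finset.sum_apply, E, Sum.inl.injEq]
  · intro w hw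
    have hS : ∀ w : Tok M L U G, (0 : ℝ) ≤ ∑ l : Fin L, ∑ u ∈ Finset.univ.erase (a (js N) l),
      (if w = Tok.attr l u then (1 : ℝ) else 0) := fun w =>
        Finset.sum_nonneg fun l _ => Finset.sum_nonneg fun u _ => by split_ifs <;> norm_num
    have hR : -(∑ l : Fin L, ∑ u ∈ Finset.univ.erase (a (js N) l),
      (if (Tok.attr lstar (a (js N) lstar) : Tok M L U G) = Tok.attr l u then (1 : ℝ) else 0))
      + ∑ u : Fin U, (if (Tok.attr lstar (a (js N) lstar) : Tok M L U G) = Tok.attr lstar u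
        then (1 : ℝ) else 0) = 1 := by
      have : ∑ l : Fin L, ∑ u ∈ Finset.univ.erase (a (js N) l),
        (if (Tok.attr lstar (a (js N) lstar) : Tok M L U G) = Tok.attr l u
          then (1 : ℝ) else 0) = 0 := by
        refine Finset.sum_eq_zero fun l _ => Finset.sum_eq_zero fun u hu => ?_
        rw [if_neg]
        intro h
        rw [Tok.attr.injEq] at h
        obtain ⟨rfl, h⟩ := h
        exact (Finset.ne_of_mem_erase hu) h.symm
      rw [this]
      simp
    dsimp only
    rw [hR]
    by_cases hl : ∃ u, w = Tok.attr lstar u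
    · obtain ⟨u, rfl⟩ := hl
      have hu : u ≠ a (js N) lstar := fun h => hw (by rw [h])
      have h1 : (1 : ℝ) ≤ ∑ l : Fin L, ∑ u' ∈ Finset.univ.erase (a (js N) l),
          (if (Tok.attr lstar u : Tok M L U G) = Tok.attr l u' then (1 : ℝ) else 0) := by
        refine le_trans ?_ (Finset.single_le_sum (fun l _ => Finset.sum_nonneg fun u _ => by
          split_ifs <;> norm_num) (Finset.mem_univ lstar))
        refine le_trans ?_ (Finset.single_le_sum (fun u _ => by
          split_ifs <;> norm_num) (Finset.mem_erase.mpr ⟨hu, Finset.mem_univ u⟩))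
        simp
      have h2 : ∑ u' : Fin U, (if (Tok.attr lstar u : Tok M L U G) = Tok.attr lstar u'
        then (1 : ℝ) else 0) = 1 := by simp
      linarith
    · have h2 : ∑ u' : Fin U, (if w = Tok.attr lstar u' then (1 : ℝ) else 0) = 0 :=
        Finset.sum_eq_zero fun u _ => if_neg fun h => hl ⟨u, h⟩
      linarith [hS w]

end CR
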